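/- For every L ≥ 0 and all indices i_1,…,i_L, j, k ∈ {1,…,N}, the L-fold nested commutator satisfies [A_{i_L}, […, [A_{i_1}, [A_j, A_k]]…]] = ( n(i_L)·…·n(i_1) ) · P^{L+2} · ( n(k)·e_jᵀ − n(j)·e_kᵀ )·n, where [X,Y] = X·Y − Y·X and (n(k)·e_jᵀ − n(j)·e_kᵀ)·n is the rank-one matrix with (r,s) entry (n(k)·e_j(r) − n(j)·e_k(r))·n(s). -/

import Mathlib

open Matrix

/-- `T k = n(k)•𝟙 − eₖᵀ·n`, where `eₖᵀ·n` is the rank-one matrix with `(i,j)` entry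
`eₖ(i)·n(j)`. -/
def Tmat {𝕜 : Type*} [RCLike 𝕜] {N : ℕ} (n : Fin N → 𝕜) (k : Fin N) :
    Matrix (Fin N) (Fin N) 𝕜 :=
  n k • (1 : Matrix (Fin N) (Fin N) 𝕜) - Matrix.vecMulVec (Pi.single k 1) n

/-- `A k = P·(T k)`. -/
def Amat {𝕜 : Type*} [RCLike 𝕜] {N : ℕ} (P : Matrix (Fin N) (Fin N) 𝕜)
    (n : Fin N → 𝕜) (k : Fin N) : Matrix (Fin N) (Fin N) 𝕜 :=
  P * Tmat n k


/-- Nested commutator `[A i_L, [⋯, [A i_1, X]⋯]]` for `is = [i_1, …, i_L]`,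
with `[X,Y] = X·Y − Y·X`. -/
def nestedComm {𝕜 : Type*} [RCLike 𝕜] {N : ℕ} (A : Fin N → Matrix (Fin N) (Fin N) 𝕜)
    (is : List (Fin N)) (X : Matrix (Fin N) (Fin N) 𝕜) : Matrix (Fin N) (Fin N) 𝕜 :=
  is.foldl (fun Y i => A i * Y - Y * A i) X

theorem Tmat_mul_of_vecMul_eq_zero {𝕜 : Type*} [RCLike 𝕜] {N : ℕ}
    {P : Matrix (Fin N) (Fin N) 𝕜} {n : Fin N → 𝕜} (hn : Matrix.vecMul n P = 0) (k : Fin N) :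
    Tmat n k * P = n k • P := by
  simp [Tmat, sub_mul, Matrix.vecMulVec_mul, hn]

theorem Amat_mul_pow_succ_mul {𝕜 : Type*} [RCLike 𝕜] {N : ℕ}
    {P : Matrix (Fin N) (Fin N) 𝕜} {n : Fin N → 𝕜} (hn : Matrix.vecMul n P = 0) (k : Fin N)
    (m : ℕ) (V : Matrix (Fin N) (Fin N) 𝕜) :
    Amat P n k * (P ^ (m + 1) * V) = n k • (P ^ (m + 2) * V) := by
  rw [Amat, pow_succ' P m, pow_succ' P (m + 1), pow_succ' P m]
  simp only [mul_assoc]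
  rw [← mul_assoc (Tmat n k) P, Tmat_mul_of_vecMul_eq_zero hn]
  simp

theorem vecMulVec_mul_Amat {𝕜 : Type*} [RCLike 𝕜] {N : ℕ}
    {P : Matrix (Fin N) (Fin N) 𝕜} {n : Fin N → 𝕜} (hn : Matrix.vecMul n P = 0) (k : Fin N)
    (u : Fin N → 𝕜) :
    Matrix.vecMulVec u n * Amat P n k = 0 := by
  rw [Amat, ← mul_assoc, Matrix.vecMulVec_mul, hn, Matrix.vecMulVec_zero, zero_mul]

theorem nestedComm_smul_pow_mul_vecMulVec {𝕜 : Type*} [RCLike 𝕜] {N : ℕ}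
    {P : Matrix (Fin N) (Fin N) 𝕜} {n : Fin N → 𝕜} (hn : Matrix.vecMul n P = 0)
    (is : List (Fin N)) (c : 𝕜) (m : ℕ) (u : Fin N → 𝕜) :
    nestedComm (Amat P n) is (c • (P ^ (m + 1) * Matrix.vecMulVec u n)) =
      (c * (is.map n).prod) • (P ^ (is.length + m + 1) * Matrix.vecMulVec u n) := by
  induction is generalizing c m with
  | nil => simp [nestedComm]
  | cons i is ih =>
    have h : Amat P n i * (c • (P ^ (m + 1) * Matrix.vecMulVec u n)) -
        c • (P ^ (m + 1) * Matrix.vecMulVec u n) * Amat P n i =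
        (c * n i) • (P ^ (m + 1 + 1) * Matrix.vecMulVec u n) := by
      rw [Matrix.mul_smul, Amat_mul_pow_succ_mul hn, Matrix.smul_mul, mul_assoc,
        vecMulVec_mul_Amat hn, mul_zero, smul_zero, sub_zero, smul_smul]
    have ih' := ih (c * n i) (m + 1)
    simp only [nestedComm, List.foldl_cons] at ih' ⊢
    rw [h, ih', List.map_cons, List.prod_cons, List.length_cons, mul_assoc,
      add_right_comm is.length 1 m, add_assoc is.length m 1]

theorem Amat_commutator {𝕜 : Type*} [RCLike 𝕜] {N : ℕ}
    {P : Matrix (Fin N) (Fin N) 𝕜} {n : Fin N → 𝕜} (hn : Matrix.vecMul n P = 0) (j k : Fin N) :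
    Amat P n j * Amat P n k - Amat P n k * Amat P n j =
      P ^ 2 * Matrix.vecMulVec
        (n k • (Pi.single j 1 : Fin N → 𝕜) - n j • (Pi.single k 1 : Fin N → 𝕜)) n := by
  have h (a b : Fin N) : Amat P n a * Amat P n b = n a • (P ^ 2 * Tmat n b) := by
    simpa [Amat] using Amat_mul_pow_succ_mul hn a 0 (Tmat n b)
  rw [h, h, ← Matrix.mul_smul, ← Matrix.mul_smul, ← mul_sub]
  congr 1
  rw [Tmat, Tmat, Matrix.sub_vecMulVec, Matrix.smul_vecMulVec, Matrix.smul_vecMulVec, smul_sub,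
    smul_sub, smul_smul, smul_smul, mul_comm (n k)]
  abel

/-- `[A i_L, [⋯, [A i_1, [A j, A k]]⋯]] = (n i_L ⋯ n i_1) • (P^(L+2) * ((n k • eⱼᵀ − n j • eₖᵀ)·n))`. -/
theorem stmt5 {𝕜 : Type*} [RCLike 𝕜] {N : ℕ} (P : Matrix (Fin N) (Fin N) 𝕜)
    (n : Fin N → 𝕜) (hn : Matrix.vecMul n P = 0) (is : List (Fin N)) (j k : Fin N) :
    nestedComm (Amat P n) is (Amat P n j * Amat P n k - Amat P n k * Amat P n j) =
      (is.map n).prod •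
        (P ^ (is.length + 2) *
          Matrix.vecMulVec (n k • (Pi.single j 1 : Fin N → 𝕜) - n j • (Pi.single k 1 : Fin N → 𝕜)) n) := by
  rw [Amat_commutator hn]
  simpa using nestedComm_smul_pow_mul_vecMulVec hn is 1 1 _
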